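/- arXiv:2508.15242 — 2 statements merged into one kernel-verified Lean document; each statement's English description precedes it below -/
import Mathlib

section
/- Let X be a finite R-module. Suppose given short exact sequences of R-modules: 0 → Y → P → X → 0 with P finite of projective dimension at most 1 over R; 0 → L → F → X → 0 with F finitely generated projective; 0 → M → F' → L → 0 with F' finitely generated projective; and 0 → L' → F'' → Y → 0 with F'' finitely generated projective. Then the R-lattices M and L' are projectively equivalent. (This expresses the commutativity Φ ∘ ω¹ = Ω ∘ Φ, where Ω is the syzygy operator on lattices up to projective equivalence.) -/
/-- `𝒪` is one of the rings `ℤ`, `ℤ[1/2]`, or `ℤ_p` for some prime `p`. -/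
def IsAllowedBase (𝒪 : Type) [CommRing 𝒪] : Prop :=
  Nonempty (𝒪 ≃+* ℤ) ∨ Nonempty (𝒪 ≃+* Localization.Away (2 : ℤ)) ∨
    ∃ (p : ℕ) (hp : p.Prime), Nonempty (𝒪 ≃+* @PadicInt p ⟨hp⟩)

/-- Projective dimension at most one. -/
def PdLeOne (R : Type) [Ring R] (X : Type) [AddCommGroup X] [Module R X] : Prop :=
  ∃ (P : Type) (_ : AddCommGroup P) (_ : Module R P) (f : P →ₗ[R] X),
    Function.Surjective f ∧ Module.Projective R P ∧
      Module.Projective R (LinearMap.ker f)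

/-- Two `R`-modules are projectively equivalent if they become isomorphic after
adding finitely generated projective direct summands. -/
def ProjEquiv (R : Type) [Ring R]
    (L : Type) [AddCommGroup L] [Module R L]
    (L' : Type) [AddCommGroup L'] [Module R L'] : Prop :=
  ∃ (F : Type) (_ : AddCommGroup F) (_ : Module R F)
    (F' : Type) (_ : AddCommGroup F') (_ : Module R F'),
      Module.Finite R F ∧ Module.Projective R F ∧
      Module.Finite R F' ∧ Module.Projective R F' ∧
      Nonempty ((L × F') ≃ₗ[R] (L' × F))

/-- Schanuel's lemma for two projective presentations of the same module. -/
theorem schanuel {R : Type*} [Ring R] {X A B K L : Type*}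
    [AddCommGroup X] [Module R X] [AddCommGroup A] [Module R A] [AddCommGroup B] [Module R B]
    [AddCommGroup K] [Module R K] [AddCommGroup L] [Module R L]
    [Module.Projective R A] [Module.Projective R B]
    {i : K →ₗ[R] A} {f : A →ₗ[R] X} {j : L →ₗ[R] B} {g : B →ₗ[R] X}
    (hi : Function.Injective i) (hf : Function.Surjective f) (hif : Function.Exact i f)
    (hj : Function.Injective j) (hg : Function.Surjective g) (hjg : Function.Exact j g) :
    Nonempty ((K × B) ≃ₗ[R] (L × A)) := by
  obtain ⟨h, hh⟩ := Module.projective_lifting_property f g hf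
  obtain ⟨k, hk⟩ := Module.projective_lifting_property g f hg
  replace hh : ∀ b, f (h b) = g b := LinearMap.congr_fun hh
  replace hk : ∀ a, g (k a) = f a := LinearMap.congr_fun hk
  let S : Submodule R (A × B) :=
    LinearMap.ker (f.comp (LinearMap.fst R A B) - g.comp (LinearMap.snd R A B))
  have hS : ∀ x : A × B, x ∈ S ↔ f x.1 = g x.2 := fun x => by
    simp [S, sub_eq_zero]
  have hfi : ∀ x, f (i x) = 0 := hif.apply_apply_eq_zero
  have hgj : ∀ x, g (j x) = 0 := hjg.apply_apply_eq_zero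
  let φ : (K × B) →ₗ[R] S :=
    LinearMap.codRestrict S
      ((i.comp (LinearMap.fst R K B) + h.comp (LinearMap.snd R K B)).prod (LinearMap.snd R K B))
      (fun x => by simp [hS, hfi, hh])
  let ψ : (L × A) →ₗ[R] S :=
    LinearMap.codRestrict S
      ((LinearMap.snd R L A).prod (j.comp (LinearMap.fst R L A) + k.comp (LinearMap.snd R L A)))
      (fun x => by simp [hS, hgj, hk])
  have hφ : Function.Bijective φ := by
    constructor
    · rintro ⟨x, b⟩ ⟨x', b'⟩ e
      obtain rfl : b = b' := congrArg (fun z : S => z.1.2) e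
      have e₁ : i x + h b = i x' + h b := congrArg (fun z : S => z.1.1) e
      rw [hi (add_right_cancel e₁)]
    · rintro ⟨⟨a, b⟩, hab⟩
      rw [hS] at hab
      obtain ⟨x, hx⟩ := (hif (a - h b)).1 (by simpa [hh, sub_eq_zero] using hab)
      exact ⟨(x, b), Subtype.ext (by simp [φ, hx])⟩
  have hψ : Function.Bijective ψ := by
    constructor
    · rintro ⟨x, a⟩ ⟨x', a'⟩ e
      obtain rfl : a = a' := congrArg (fun z : S => z.1.1) e
      have e₁ : j x + k a = j x' + k a := congrArg (fun z : S => z.1.2) e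
      rw [hj (add_right_cancel e₁)]
    · rintro ⟨⟨a, b⟩, hab⟩
      rw [hS] at hab
      obtain ⟨x, hx⟩ := (hjg (b - k a)).1 (by simpa [hk, sub_eq_zero] using hab.symm)
      exact ⟨(x, a), Subtype.ext (by simp [ψ, hx])⟩
  exact ⟨(LinearEquiv.ofBijective φ hφ).trans (LinearEquiv.ofBijective ψ hψ).symm⟩

/-- If `P` has projective dimension at most one, then the kernel of any surjection from a
projective module onto `P` is projective. -/
theorem PdLeOne.projective_ker {R : Type} [Ring R] {P : Type} [AddCommGroup P] [Module R P]
    (hP : PdLeOne R P) {A : Type*} [AddCommGroup A] [Module R A] [Module.Projective R A]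
    (q : A →ₗ[R] P) (hq : Function.Surjective q) : Module.Projective R (LinearMap.ker q) := by
  obtain ⟨Q, _, _, f, hf, _, _⟩ := hP
  obtain ⟨e⟩ := schanuel (LinearMap.ker q).injective_subtype hq (LinearMap.exact_subtype_ker_map q)
    (LinearMap.ker f).injective_subtype hf (LinearMap.exact_subtype_ker_map f)
  have := Module.Projective.of_equiv e.symm
  exact Module.Projective.of_split (LinearMap.inl R (LinearMap.ker q) Q) (LinearMap.fst R _ _)
    (LinearMap.fst_comp_inl R _ _)

theorem IsAllowedBase.isNoetherianRing {𝒪 : Type} [CommRing 𝒪] (h : IsAllowedBase 𝒪) :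
    IsNoetherianRing 𝒪 := by
  obtain ⟨⟨e⟩⟩ | ⟨⟨e⟩⟩ | ⟨p, hp, ⟨e⟩⟩ := h
  · exact isNoetherianRing_of_ringEquiv ℤ e.symm
  · have := IsLocalization.isNoetherianRing (Submonoid.powers (2 : ℤ))
      (Localization.Away (2 : ℤ)) inferInstance
    exact isNoetherianRing_of_ringEquiv _ e.symm
  · have : Fact p.Prime := ⟨hp⟩
    exact isNoetherianRing_of_ringEquiv _ e.symm

theorem MonoidAlgebra.isNoetherianRing_of_finite (A G : Type*) [CommRing A] [IsNoetherianRing A]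
    [Monoid G] [Finite G] : IsNoetherianRing (MonoidAlgebra A G) := by
  have : Module.Finite A (MonoidAlgebra A G) := inferInstance
  exact isNoetherian_of_tower A inferInstance

theorem Function.Exact.inl_comp_prodMap_id {R K A X : Type*} (B : Type*) [Ring R]
    [AddCommGroup K] [Module R K] [AddCommGroup A] [Module R A] [AddCommGroup X] [Module R X]
    [AddCommGroup B] [Module R B] {i : K →ₗ[R] A} {f : A →ₗ[R] X} (h : Function.Exact i f) :
    Function.Exact ((LinearMap.inl R A B).comp i)
      (f.prodMap (LinearMap.id : B →ₗ[R] B)) := by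
  rintro ⟨a, b⟩
  simp [h a, eq_comm (a := b)]

/-- Let `Y` be the kernel of a surjection `P → X` with `P` finitely generated of projective
dimension at most one over a Noetherian ring. Then a first syzygy of `Y` is projectively
equivalent to a second syzygy of `X`. -/
theorem projEquiv_second_syzygy_syzygy {R : Type} [Ring R] [IsNoetherianRing R]
    {X Y P L M L' F F' F'' : Type}
    [AddCommGroup X] [Module R X] [AddCommGroup Y] [Module R Y]
    [AddCommGroup P] [Module R P] [Module.Finite R P]
    [AddCommGroup L] [Module R L] [AddCommGroup M] [Module R M]
    [AddCommGroup L'] [Module R L']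
    [AddCommGroup F] [Module R F] [Module.Finite R F] [Module.Projective R F]
    [AddCommGroup F'] [Module R F'] [Module.Finite R F'] [Module.Projective R F']
    [AddCommGroup F''] [Module R F''] [Module.Finite R F''] [Module.Projective R F'']
    (hP : PdLeOne R P)
    {iY : Y →ₗ[R] P} {πP : P →ₗ[R] X} (hiY : Function.Injective iY)
    (hπP : Function.Surjective πP) (hYP : Function.Exact iY πP)
    {iL : L →ₗ[R] F} {πF : F →ₗ[R] X} (hiL : Function.Injective iL)
    (hπF : Function.Surjective πF) (hLF : Function.Exact iL πF)
    {iM : M →ₗ[R] F'} {πF' : F' →ₗ[R] L} (hiM : Function.Injective iM)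
    (hπF' : Function.Surjective πF') (hMF' : Function.Exact iM πF')
    {iL' : L' →ₗ[R] F''} {πF'' : F'' →ₗ[R] Y} (hiL' : Function.Injective iL')
    (hπF'' : Function.Surjective πF'') (hLF'' : Function.Exact iL' πF'') :
    ProjEquiv R M L' := by
  obtain ⟨n, q, hq⟩ := Module.Finite.exists_fin' R P
  have := hP.projective_ker q hq
  let N := LinearMap.ker (πP.comp q)
  obtain ⟨e⟩ := schanuel hiL hπF hLF N.injective_subtype (hπP.comp hq)
    (LinearMap.exact_subtype_ker_map (πP.comp q))
  obtain ⟨h, hh⟩ := Module.projective_lifting_property q (iY.comp πF'') hq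
  replace hh : ∀ b, q (h b) = iY (πF'' b) := LinearMap.congr_fun hh
  have hπi : ∀ y, πP (iY y) = 0 := hYP.apply_apply_eq_zero
  let t : (LinearMap.ker q × F'') →ₗ[R] N :=
    LinearMap.codRestrict N (LinearMap.coprod (LinearMap.ker q).subtype h)
      (fun x => by
        have := LinearMap.mem_ker.1 x.1.2
        simp [N, hh, hπi, this])
  have ht : ∀ x, (t x : Fin n → R) = x.1 + h x.2 := fun _ => rfl
  have ht_surj : Function.Surjective t := by
    rintro ⟨a, ha⟩
    obtain ⟨y, hy⟩ := (hYP (q a)).1 (by simpa [N] using ha)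
    obtain ⟨b, rfl⟩ := hπF'' y
    exact ⟨(⟨a - h b, by simp [hh, hy]⟩, b), Subtype.ext (by simp [ht])⟩
  have hπi' : ∀ x, πF'' (iL' x) = 0 := hLF''.apply_apply_eq_zero
  let j : L' →ₗ[R] LinearMap.ker q × F'' :=
    (LinearMap.codRestrict (LinearMap.ker q) (-(h.comp iL')) (fun x => by
      simp [hh, hπi'])).prod iL'
  have hj : Function.Injective j := fun x y hxy => hiL' (congrArg Prod.snd hxy)
  have hjt : Function.Exact j t := by
    rintro ⟨a, b⟩
    constructor
    · intro hab
      have hab' : (a : Fin n → R) + h b = 0 := by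
        simpa [ht] using congrArg Subtype.val hab
      have hb : πF'' b = 0 := hiY (by
        rw [← hh, map_zero, ← map_zero q, ← hab', map_add, LinearMap.mem_ker.1 a.2, zero_add])
      obtain ⟨x, rfl⟩ := (hLF'' b).1 hb
      exact ⟨x, Prod.ext (Subtype.ext (by simpa [j] using (eq_neg_of_add_eq_zero_left hab').symm))
        rfl⟩
    · rintro ⟨x, hx⟩
      rw [← hx]
      exact Subtype.ext (by simp [ht, j])
  obtain ⟨e'⟩ := schanuel
    (i := (LinearMap.inl R F' (Fin n → R)).comp iM)
    (f := e.toLinearMap.comp (πF'.prodMap LinearMap.id))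
    (j := (LinearMap.inl R _ F).comp j)
    (g := t.prodMap LinearMap.id)
    (LinearMap.inl_injective.comp hiM)
    (e.surjective.comp (hπF'.prodMap Function.surjective_id))
    ((hMF'.inl_comp_prodMap_id _).comp_injective e e.injective (map_zero e))
    (LinearMap.inl_injective.comp hj)
    (ht_surj.prodMap Function.surjective_id)
    (hjt.inl_comp_prodMap_id F)
  exact ⟨_, _, _, _, _, _, inferInstance, inferInstance, inferInstance, inferInstance, ⟨e'⟩⟩


/-- Commutativity `Φ ∘ ω¹ = Ω ∘ Φ`: given a finite module `X` over `R = 𝒪[Γ₀]`,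
short exact sequences `0 → Y → P → X → 0` with `P` finite of projective dimension
at most one, `0 → L → F → X → 0`, `0 → M → F' → L → 0` and `0 → L' → F'' → Y → 0`
with `F`, `F'`, `F''` finitely generated projective, the lattices `M` and `L'`
are projectively equivalent. -/
theorem phi_omega_commute
    (𝒪 : Type) [CommRing 𝒪] (h𝒪 : IsAllowedBase 𝒪)
    (Γ₀ : Type) [Group Γ₀] [Finite Γ₀]
    (X : Type) [AddCommGroup X] [Module (MonoidAlgebra 𝒪 Γ₀) X] [Finite X]
    (Y : Type) [AddCommGroup Y] [Module (MonoidAlgebra 𝒪 Γ₀) Y]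
    (P : Type) [AddCommGroup P] [Module (MonoidAlgebra 𝒪 Γ₀) P] [Finite P]
    (L : Type) [AddCommGroup L] [Module (MonoidAlgebra 𝒪 Γ₀) L]
    (M : Type) [AddCommGroup M] [Module (MonoidAlgebra 𝒪 Γ₀) M]
    (L' : Type) [AddCommGroup L'] [Module (MonoidAlgebra 𝒪 Γ₀) L']
    (F : Type) [AddCommGroup F] [Module (MonoidAlgebra 𝒪 Γ₀) F]
    (F' : Type) [AddCommGroup F'] [Module (MonoidAlgebra 𝒪 Γ₀) F']
    (F'' : Type) [AddCommGroup F''] [Module (MonoidAlgebra 𝒪 Γ₀) F'']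
    (hP : PdLeOne (MonoidAlgebra 𝒪 Γ₀) P)
    (hF : Module.Finite (MonoidAlgebra 𝒪 Γ₀) F)
    (hFproj : Module.Projective (MonoidAlgebra 𝒪 Γ₀) F)
    (hF' : Module.Finite (MonoidAlgebra 𝒪 Γ₀) F')
    (hF'proj : Module.Projective (MonoidAlgebra 𝒪 Γ₀) F')
    (hF'' : Module.Finite (MonoidAlgebra 𝒪 Γ₀) F'')
    (hF''proj : Module.Projective (MonoidAlgebra 𝒪 Γ₀) F'')
    -- 0 → Y → P → X → 0
    (iY : Y →ₗ[MonoidAlgebra 𝒪 Γ₀] P) (πP : P →ₗ[MonoidAlgebra 𝒪 Γ₀] X)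
    (hiY : Function.Injective iY) (hπP : Function.Surjective πP)
    (hex1 : LinearMap.range iY = LinearMap.ker πP)
    -- 0 → L → F → X → 0
    (iL : L →ₗ[MonoidAlgebra 𝒪 Γ₀] F) (πF : F →ₗ[MonoidAlgebra 𝒪 Γ₀] X)
    (hiL : Function.Injective iL) (hπF : Function.Surjective πF)
    (hex2 : LinearMap.range iL = LinearMap.ker πF)
    -- 0 → M → F' → L → 0
    (iM : M →ₗ[MonoidAlgebra 𝒪 Γ₀] F') (πF' : F' →ₗ[MonoidAlgebra 𝒪 Γ₀] L)
    (hiM : Function.Injective iM) (hπF' : Function.Surjective πF')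
    (hex3 : LinearMap.range iM = LinearMap.ker πF')
    -- 0 → L' → F'' → Y → 0
    (iL' : L' →ₗ[MonoidAlgebra 𝒪 Γ₀] F'') (πF'' : F'' →ₗ[MonoidAlgebra 𝒪 Γ₀] Y)
    (hiL' : Function.Injective iL') (hπF'' : Function.Surjective πF'')
    (hex4 : LinearMap.range iL' = LinearMap.ker πF'') :
    ProjEquiv (MonoidAlgebra 𝒪 Γ₀) M L' := by
  have := h𝒪.isNoetherianRing
  have := MonoidAlgebra.isNoetherianRing_of_finite 𝒪 Γ₀
  exact projEquiv_second_syzygy_syzygy hP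
    hiY hπP (LinearMap.exact_iff.2 hex1.symm) hiL hπF (LinearMap.exact_iff.2 hex2.symm)
    hiM hπF' (LinearMap.exact_iff.2 hex3.symm) hiL' hπF'' (LinearMap.exact_iff.2 hex4.symm)
end

section
/- For any two generators φ and φ' of the cyclic group D/I, the finite ℤ[G]-modules A_{I,φ} and A_{I,φ'} are equivalent: A_{I,φ} ∼ A_{I,φ'}. (Thus the equivalence class of A_{I,φ} is independent of the choice of generator of D/I.) -/
/-- Equivalence of finite `R`-modules. -/
def ModEquiv (R : Type) [Ring R]
    (X : Type) [AddCommGroup X] [Module R X]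
    (Y : Type) [AddCommGroup Y] [Module R Y] : Prop :=
  ∃ (M : Type) (_ : AddCommGroup M) (_ : Module R M)
    (N : Type) (_ : AddCommGroup N) (_ : Module R N),
      Finite M ∧ Finite N ∧ Nonempty (M ≃ₗ[R] N) ∧
      ∃ (M' M'' : Submodule R M) (N' N'' : Submodule R N),
        M' ≤ M'' ∧ N' ≤ N'' ∧
        PdLeOne R M' ∧ PdLeOne R N' ∧
        PdLeOne R (M ⧸ M'') ∧ PdLeOne R (N ⧸ N'') ∧
        Nonempty ((M'' ⧸ (M'.comap M''.subtype)) ≃ₗ[R] X) ∧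
        Nonempty ((N'' ⧸ (N'.comap N''.subtype)) ≃ₗ[R] Y)

/-- The left ideal of `ℤ[G]` generated by the image of the kernel of
`ℤ[D] → ℤ[D/I]/(g_φ)`, where `g_φ = 1 − φ⁻¹ + #I`.  The quotient of `ℤ[G]`
by this left ideal realizes the induced module
`A_{I,φ} = ℤ[G] ⊗_{ℤ[D]} (ℤ[D/I]/(g_φ))`, since `ℤ[G]` is free over `ℤ[D]`. -/
noncomputable def relationIdeal (G : Type) [Group G] [Finite G]
    (D I : Subgroup G) (hID : I ≤ D) [(I.subgroupOf D).Normal]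
    (φ : ↥D ⧸ I.subgroupOf D) : Submodule (MonoidAlgebra ℤ G) (MonoidAlgebra ℤ G) :=
  Submodule.span (MonoidAlgebra ℤ G)
    ((MonoidAlgebra.mapDomainRingHom ℤ D.subtype) ''
      {x : MonoidAlgebra ℤ ↥D |
        MonoidAlgebra.mapDomainRingHom ℤ (QuotientGroup.mk' (I.subgroupOf D)) x ∈
          Ideal.span {1 - MonoidAlgebra.of ℤ (↥D ⧸ I.subgroupOf D) φ⁻¹ +
            (Nat.card I : MonoidAlgebra ℤ (↥D ⧸ I.subgroupOf D))}})

/-- The finite `ℤ[G]`-module `A_{I,φ} = ℤ[G] ⊗_{ℤ[D]} (ℤ[D/I]/(g_φ))`,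
presented as the quotient of `ℤ[G]` by the corresponding left ideal. -/
noncomputable def Amod (G : Type) [Group G] [Finite G]
    (D I : Subgroup G) (hID : I ≤ D) [(I.subgroupOf D).Normal]
    (φ : ↥D ⧸ I.subgroupOf D) : Type :=
  MonoidAlgebra ℤ G ⧸ relationIdeal G D I hID φ

noncomputable instance (G : Type) [Group G] [Finite G]
    (D I : Subgroup G) (hID : I ≤ D) [(I.subgroupOf D).Normal]
    (φ : ↥D ⧸ I.subgroupOf D) : AddCommGroup (Amod G D I hID φ) :=
  inferInstanceAs (AddCommGroup (MonoidAlgebra ℤ G ⧸ relationIdeal G D I hID φ))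

noncomputable instance (G : Type) [Group G] [Finite G]
    (D I : Subgroup G) (hID : I ≤ D) [(I.subgroupOf D).Normal]
    (φ : ↥D ⧸ I.subgroupOf D) : Module (MonoidAlgebra ℤ G) (Amod G D I hID φ) :=
  inferInstanceAs (Module (MonoidAlgebra ℤ G)
    (MonoidAlgebra ℤ G ⧸ relationIdeal G D I hID φ))

section PdLeOne

variable {R : Type} [Ring R] {X Y : Type} [AddCommGroup X] [Module R X]
  [AddCommGroup Y] [Module R Y]

theorem PdLeOne.of_surjective (f : R →ₗ[R] X) (hf : Function.Surjective f)
    (hK : Module.Projective R (LinearMap.ker f)) : PdLeOne R X :=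
  ⟨R, inferInstance, inferInstance, f, hf, inferInstance, hK⟩

theorem PdLeOne.of_linearEquiv (e : X ≃ₗ[R] Y) (h : PdLeOne R X) : PdLeOne R Y := by
  obtain ⟨P, _, _, f, hf, hP, hK⟩ := h
  refine ⟨P, inferInstance, inferInstance, e.toLinearMap ∘ₗ f, e.surjective.comp hf, hP, ?_⟩
  rwa [LinearEquiv.ker_comp]

theorem PdLeOne.of_subsingleton [Subsingleton X] : PdLeOne R X :=
  ⟨X, inferInstance, inferInstance, LinearMap.id, Function.surjective_id, inferInstance,
    inferInstance⟩

theorem PdLeOne.ker_comp {W : Type} [AddCommGroup W] [Module R W] (e : W ≃ₗ[R] X)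
    (p : X →ₗ[R] Y) (h : PdLeOne R (LinearMap.ker p)) :
    PdLeOne R (LinearMap.ker (p ∘ₗ e.toLinearMap)) :=
  .of_linearEquiv (LinearEquiv.ofSubmodule' e (LinearMap.ker p)).symm h

/-- Right multiplication by a right-regular element identifies `R` with the left ideal
it generates. -/
noncomputable def spanSingletonEquiv (y : R) (hy : ∀ s : R, s * y = 0 → s = 0) :
    R ≃ₗ[R] Submodule.span R {y} :=
  LinearEquiv.ofInjective (LinearMap.toSpanSingleton R R y)
      ((injective_iff_map_eq_zero _).2 fun s hs => hy s (by simpa using hs)) ≪≫ₗ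
    LinearEquiv.ofEq _ _ (LinearMap.range_toSpanSingleton y)

theorem PdLeOne.quotient_span_singleton (y : R) (hy : ∀ s : R, s * y = 0 → s = 0) :
    PdLeOne R (R ⧸ Submodule.span R {y}) := by
  refine .of_surjective (Submodule.mkQ _) (Submodule.mkQ_surjective _) ?_
  rw [Submodule.ker_mkQ]
  exact Module.Projective.of_equiv (spanSingletonEquiv y hy)

theorem finite_quotient_span_singleton [Module.Free ℤ R] [Module.Finite ℤ R]
    (y : R) (hy : ∀ s : R, s * y = 0 → s = 0) :
    Finite (R ⧸ Submodule.span R {y}) :=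
  Submodule.finiteQuotientOfFreeOfRankEq ((Submodule.span R {y}).restrictScalars ℤ)
    (((spanSingletonEquiv y hy).restrictScalars ℤ).finrank_eq).symm

end PdLeOne

section Pullback

variable {R : Type} [Ring R] {A B Z X Y : Type}
  [AddCommGroup A] [Module R A] [AddCommGroup B] [Module R B] [AddCommGroup Z] [Module R Z]
  [AddCommGroup X] [Module R X] [AddCommGroup Y] [Module R Y]

/-- The kernel of the second projection of a fibre product is the kernel of the first map. -/
noncomputable def kerSndEquiv (α : A →ₗ[R] Z) (β : B →ₗ[R] Z) :
    LinearMap.ker (LinearMap.snd R A B ∘ₗ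
      (LinearMap.eqLocus (α ∘ₗ LinearMap.fst R A B) (β ∘ₗ LinearMap.snd R A B)).subtype) ≃ₗ[R]
    LinearMap.ker α where
  toFun m := ⟨m.1.1.1, by
    have h1 : α m.1.1.1 = β m.1.1.2 := m.1.2
    have h2 : m.1.1.2 = 0 := m.2
    simp [h1, h2]⟩
  map_add' _ _ := rfl
  map_smul' _ _ := rfl
  invFun a := ⟨⟨(a.1, 0), by simp [LinearMap.mem_eqLocus]⟩, by simp⟩
  left_inv m := by
    have h2 : m.1.1.2 = 0 := m.2
    ext <;> simp [h2]
  right_inv _ := rfl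

/-- The kernel of the first projection of a fibre product is the kernel of the second map. -/
noncomputable def kerFstEquiv (α : A →ₗ[R] Z) (β : B →ₗ[R] Z) :
    LinearMap.ker (LinearMap.fst R A B ∘ₗ
      (LinearMap.eqLocus (α ∘ₗ LinearMap.fst R A B) (β ∘ₗ LinearMap.snd R A B)).subtype) ≃ₗ[R]
    LinearMap.ker β where
  toFun m := ⟨m.1.1.2, by
    have h1 : α m.1.1.1 = β m.1.1.2 := m.1.2
    have h2 : m.1.1.1 = 0 := m.2
    simp [← h1, h2]⟩
  map_add' _ _ := rfl
  map_smul' _ _ := rfl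
  invFun a := ⟨⟨(0, a.1), by simp [LinearMap.mem_eqLocus]⟩, by simp⟩
  left_inv m := by
    have h2 : m.1.1.1 = 0 := m.2
    ext <;> simp [h2]
  right_inv _ := rfl

/-- The kernels of two surjections from a finite module onto modules of projective dimension
at most one are equivalent, also after dividing one kernel by such a module. -/
theorem modEquiv_of_surjective {M W : Type} [AddCommGroup M] [Module R M] [Finite M]
    [AddCommGroup W] [Module R W]
    (hA : PdLeOne R A) (hB : PdLeOne R B) (a : M →ₗ[R] A) (b : M →ₗ[R] B)
    (ha : Function.Surjective a) (hb : Function.Surjective b)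
    (i : LinearMap.ker b ≃ₗ[R] W) (p : W →ₗ[R] X) (hp : Function.Surjective p)
    (hT : PdLeOne R (LinearMap.ker p)) (e : LinearMap.ker a ≃ₗ[R] Y) :
    ModEquiv R X Y := by
  let q : LinearMap.ker b →ₗ[R] X := p ∘ₗ i.toLinearMap
  have hq : Function.Surjective q := hp.comp i.surjective
  refine ⟨M, inferInstance, inferInstance, M, inferInstance, inferInstance, inferInstance,
    inferInstance, ⟨LinearEquiv.refl R M⟩,
    (LinearMap.ker q).map (LinearMap.ker b).subtype, LinearMap.ker b, ⊥, LinearMap.ker a,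
    Submodule.map_subtype_le _ _, bot_le, ?_, .of_subsingleton, ?_, ?_, ?_, ?_⟩
  · exact .of_linearEquiv (Submodule.equivMapOfInjective (LinearMap.ker b).subtype
      (Submodule.subtype_injective _) (LinearMap.ker q)) (hT.ker_comp i p)
  · exact .of_linearEquiv (b.quotKerEquivOfSurjective hb).symm hB
  · exact .of_linearEquiv (a.quotKerEquivOfSurjective ha).symm hA
  · rw [Submodule.comap_map_eq_of_injective (Submodule.subtype_injective _)]
    exact ⟨q.quotKerEquivOfSurjective hq⟩
  · have h : Submodule.comap (LinearMap.ker a).subtype ⊥ = ⊥ :=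
      LinearMap.ker_eq_bot.2 (Submodule.subtype_injective _)
    exact ⟨Submodule.quotEquivOfEqBot _ h ≪≫ₗ e⟩

/-- Two finite modules of projective dimension at most one with a common quotient relate
the kernels of the quotient maps. -/
theorem modEquiv_of_pullback [Finite A] [Finite B] (hA : PdLeOne R A) (hB : PdLeOne R B)
    (α : A →ₗ[R] Z) (β : B →ₗ[R] Z)
    (hα : Function.Surjective α) (hβ : Function.Surjective β)
    (p : LinearMap.ker α →ₗ[R] X) (hp : Function.Surjective p)
    (hT : PdLeOne R (LinearMap.ker p)) (e : LinearMap.ker β ≃ₗ[R] Y) :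
    ModEquiv R X Y := by
  refine modEquiv_of_surjective hA hB
    (LinearMap.fst R A B ∘ₗ (LinearMap.eqLocus (α ∘ₗ LinearMap.fst R A B)
      (β ∘ₗ LinearMap.snd R A B)).subtype)
    (LinearMap.snd R A B ∘ₗ (LinearMap.eqLocus (α ∘ₗ LinearMap.fst R A B)
      (β ∘ₗ LinearMap.snd R A B)).subtype) ?_ ?_
    (kerSndEquiv α β) p hp hT (kerFstEquiv α β ≪≫ₗ e)
  · intro x
    obtain ⟨z, hz⟩ := hβ (α x)
    exact ⟨⟨(x, z), hz.symm⟩, rfl⟩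
  · intro x
    obtain ⟨z, hz⟩ := hα (β x)
    exact ⟨⟨(z, x), hz⟩, rfl⟩

end Pullback

section Factor

variable {R : Type} [Ring R]

/-- The kernel of `R ⧸ Ry → R ⧸ (Rv + Ry)` is the image of right multiplication by `v`. -/
theorem ker_factor_eq_range (v y : R) (J : Submodule R R)
    (h : Submodule.span R {y} ≤ J) (hJ : ∀ r, r ∈ J ↔ ∃ a b, r = a * v + b * y) :
    LinearMap.range ((Submodule.mkQ (Submodule.span R {y})) ∘ₗ LinearMap.toSpanSingleton R R v) =
      LinearMap.ker (Submodule.factor h) := by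
  ext x
  obtain ⟨r, rfl⟩ := Submodule.mkQ_surjective _ x
  have h1 : Submodule.mkQ _ r ∈ LinearMap.ker (Submodule.factor h) ↔ r ∈ J :=
    Submodule.Quotient.mk_eq_zero J
  have h2 (s : R) : Submodule.mkQ (Submodule.span R {y}) (s * v) = Submodule.mkQ _ r ↔
      ∃ t, t * y = s * v - r :=
    (Submodule.Quotient.eq _).trans Submodule.mem_span_singleton
  rw [h1, hJ]
  refine (exists_congr fun s => h2 s).trans (exists_congr fun s => ?_)
  constructor
  · rintro ⟨t, ht⟩
    exact ⟨-t, by rw [neg_mul, ht]; abel⟩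
  · rintro ⟨t, rfl⟩
    exact ⟨-t, by rw [neg_mul]; abel⟩

/-- The left ideal of all `r` with `r v ∈ R y`. -/
def colonIdeal (v y : R) : Submodule R R :=
  (Submodule.span R {y}).comap (LinearMap.toSpanSingleton R R v)

theorem mem_colonIdeal {v y r : R} : r ∈ colonIdeal v y ↔ ∃ s, r * v = s * y :=
  Submodule.mem_span_singleton.trans (exists_congr fun _ => eq_comm)

/-- The quotient of `R` by `{r | r v ∈ R y}` is the kernel of `R ⧸ Ry → R ⧸ (Rv + Ry)`. -/
noncomputable def quotEquivKerFactor (v y : R) (J : Submodule R R)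
    (h : Submodule.span R {y} ≤ J) (hJ : ∀ r, r ∈ J ↔ ∃ a b, r = a * v + b * y) :
    (R ⧸ colonIdeal v y) ≃ₗ[R] LinearMap.ker (Submodule.factor h) :=
  Submodule.quotEquivOfEq _ _ (by
      rw [LinearMap.ker_comp, Submodule.ker_mkQ]; rfl) ≪≫ₗ
    LinearMap.quotKerEquivRange _ ≪≫ₗ LinearEquiv.ofEq _ _ (ker_factor_eq_range v y J h hJ)

end Factor

section Core

open Finset

variable {C : Type} [CommRing C]

/-- If `p ^ f` fixes `v` and `f` is prime to `k`, then `(p - 1) v` is a multiple of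
`(p ^ k - 1) v`. -/
theorem exists_sub_one_mul_eq {v p : C} {f k : ℕ} (hf : p ^ f * v = v) (hfk : k.Coprime f) :
    ∃ P : C, (p - 1) * v = P * (p - 1) * ((∑ i ∈ range k, p ^ i) * v) := by
  have h : p - 1 ∈ Ideal.span {p ^ k - 1, p ^ f - 1} := by
    rw [← Ideal.Quotient.eq_zero_iff_mem, map_sub, map_one, sub_eq_zero]
    have hk : Ideal.Quotient.mk (Ideal.span {p ^ k - 1, p ^ f - 1}) p ^ k = 1 := by
      rw [← sub_eq_zero, ← map_pow, ← map_one (Ideal.Quotient.mk _), ← map_sub,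
        Ideal.Quotient.eq_zero_iff_mem]
      exact Ideal.subset_span (by simp)
    have hf : Ideal.Quotient.mk (Ideal.span {p ^ k - 1, p ^ f - 1}) p ^ f = 1 := by
      rw [← sub_eq_zero, ← map_pow, ← map_one (Ideal.Quotient.mk _), ← map_sub,
        Ideal.Quotient.eq_zero_iff_mem]
      exact Ideal.subset_span (by simp)
    simpa [hfk.gcd_eq_one] using pow_gcd_eq_one.2 ⟨hk, hf⟩
  obtain ⟨P, Q, hPQ⟩ := Ideal.mem_span_pair.1 h
  refine ⟨P, ?_⟩
  linear_combination -v * hPQ + Q * hf - P * v * geom_sum_mul p k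

theorem exists_geom_sum_eq (p : C) (k : ℕ) :
    ∃ c : C, ∑ i ∈ range k, p ^ i = k + c * (p - 1) := by
  have h : p - 1 ∣ ∑ i ∈ range k, (p ^ i - 1) :=
    dvd_sum fun i _ => sub_one_dvd_pow_sub_one p i
  obtain ⟨c, hc⟩ := h
  refine ⟨c, ?_⟩
  rw [sum_sub_distrib] at hc
  simp at hc
  linear_combination hc

variable {R : Type} [Ring R]

/-- The left ideal of all `r` with `r v ∈ R u v`, where `u = 1 + p + ⋯ + p ^ (k - 1)`, is
projective when `k` is prime to the order of the group generated by `p` and the support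
of `v`. -/
theorem projective_colonIdeal [IsAddTorsionFree R] (ι : C →+* R) {v p : C} {n f k : ℕ}
    (hv : v * v = n * v) (hf : p ^ f * v = v) (hk : k ≠ 0) (hkn : k.Coprime (n * f)) :
    Module.Projective R (colonIdeal (ι v) (ι ((∑ i ∈ range k, p ^ i) * v))) := by
  set u : C := ∑ i ∈ range k, p ^ i with hu
  set N : C := (∑ i ∈ range f, p ^ i) * v with hN
  obtain ⟨P, hP⟩ := exists_sub_one_mul_eq hf (hkn.coprime_mul_left_right)
  rw [← hu] at hP
  obtain ⟨c, hc⟩ := exists_geom_sum_eq p k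
  obtain ⟨c', hc'⟩ := exists_geom_sum_eq p f
  rw [← hu] at hc
  have hNp : N * (p - 1) = 0 := by
    rw [hN]
    linear_combination v * geom_sum_mul p f + hf
  have hNu : u * N = k * N := by linear_combination N * hc + c * hNp
  obtain ⟨j, d, hjd⟩ : ∃ j d : ℤ, (k : ℤ) * j + (n * f : ℕ) * d = 1 :=
    ⟨_, _, by rw [← Nat.gcd_eq_gcd_ab, hkn.gcd_eq_one]; rfl⟩
  have hjd' : (k : C) * j + n * f * d = 1 := by exact_mod_cast congrArg (Int.cast : ℤ → C) hjd
  have hkv : (k : C) * v = (1 - c * P * (p - 1)) * (u * v) := by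
    linear_combination -v * hc - c * hP
  have hk_mem (a : C) : ι (a * k) ∈ colonIdeal (ι v) (ι (u * v)) :=
    mem_colonIdeal.2 ⟨ι (a * (1 - c * P * (p - 1))), by
      rw [← map_mul, ← map_mul]
      congr 1
      linear_combination a * hkv⟩
  have he_mem : ι (1 - d * N) ∈ colonIdeal (ι v) (ι (u * v)) :=
    mem_colonIdeal.2 ⟨ι (j * (1 - c * P * (p - 1)) - d * n * c' * P * (p - 1)), by
      rw [← map_mul, ← map_mul]
      congr 1
      rw [hN]
      linear_combination -v * hjd' + j * hkv - d * n * v * hc' -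
        d * (∑ i ∈ range f, p ^ i) * hv - d * n * c' * hP⟩
  set K := colonIdeal (ι v) (ι (u * v)) with hK
  have hinj : Function.Injective (LinearMap.toSpanSingleton R R (ι k)) := by
    refine (injective_iff_map_eq_zero _).2 fun s hs => ?_
    rw [LinearMap.toSpanSingleton_apply, smul_eq_mul, map_natCast, ← nsmul_eq_mul'] at hs
    exact (smul_eq_zero.1 hs).resolve_left hk
  have hdiv (r : K) : LinearMap.toSpanSingleton R R (ι N) r ∈
      LinearMap.range (LinearMap.toSpanSingleton R R (ι k)) := by
    obtain ⟨t, ht⟩ := mem_colonIdeal.1 r.2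
    refine ⟨t * ι N, ?_⟩
    have h1 : (r : R) * ι N = r * ι v * ι (∑ i ∈ range f, p ^ i) := by
      rw [hN, mul_assoc, ← map_mul, mul_comm v]
    have h2 : u * v * (∑ i ∈ range f, p ^ i) = N * k := by
      rw [mul_comm N, ← hNu, hN]; ring
    change t * ι N * ι k = r * ι N
    rw [h1, ht, mul_assoc, mul_assoc, ← map_mul, ← map_mul, h2]
  let β : K →ₗ[R] R := (LinearEquiv.ofInjective _ hinj).symm.toLinearMap ∘ₗ
    LinearMap.codRestrict _ (LinearMap.toSpanSingleton R R (ι N) ∘ₗ K.subtype) hdiv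
  have hβ (r : K) : β r * ι k = r * ι N :=
    congrArg Subtype.val ((LinearEquiv.ofInjective _ hinj).apply_symm_apply
      (⟨_, hdiv r⟩ : LinearMap.range (LinearMap.toSpanSingleton R R (ι k))))
  refine Module.Projective.of_split (K.subtype.prod β)
    (LinearMap.coprod (LinearMap.toSpanSingleton R K ⟨_, he_mem⟩)
      (LinearMap.toSpanSingleton R K ⟨_, hk_mem d⟩)) (LinearMap.ext fun r => Subtype.ext ?_)
  change (r : R) * ι (1 - d * N) + β r * ι (d * k) = r
  rw [mul_comm (d : C) k, map_mul ι (k : C), ← mul_assoc (β r), hβ, mul_assoc, ← map_mul,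
    ← mul_add, ← map_add]
  ring_nf
  simp

/-- The comparison of the two modules cut out by `p` and its power `p ^ k`. -/
theorem modEquiv_colonIdeal {R : Type} [Ring R] [Module.Free ℤ R] [Module.Finite ℤ R]
    (ι : C →+* R) {v p : C} {n f k m : ℕ} (hn : n ≠ 0)
    (hv : v * v = n * v) (hf : p ^ f * v = v) (hk : k ≠ 0) (hkn : k.Coprime (n * f))
    (hm : m ≠ 0) (hpm : p ^ m = 1)
    (hsat : ∀ (a : ℤ) (s t : R), a ≠ 0 → a • s = t * ι v → ∃ t', s = t' * ι v) :
    ModEquiv R (R ⧸ colonIdeal (ι v) (ι ((1 + n - p) * v)))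
      (R ⧸ colonIdeal (ι v) (ι ((1 + n - p ^ k) * v))) := by
  have : IsAddTorsionFree R := Module.isTorsionFree_int_iff_isAddTorsionFree.1 inferInstance
  set u : C := ∑ i ∈ range k, p ^ i with hu
  obtain ⟨P, hP⟩ := exists_sub_one_mul_eq hf (hkn.coprime_mul_left_right)
  obtain ⟨c, hc⟩ := exists_geom_sum_eq p k
  rw [← hu] at hc hP
  have hpk : u * (p - 1) = p ^ k - 1 := geom_sum_mul p k
  set w : C := 1 + n - p with hw
  set y' : C := 1 + n - p ^ k with hy'
  set y : C := y' + (u - 1) * v with hy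
  have hyv : y * v = u * w * v := by
    rw [hy, hy', hw]
    linear_combination (u - 1) * hv + v * hpk
  have hdvd (q : C) (hq : q ^ m = 1) : ∃ (a : ℤ) (b : C), a ≠ 0 ∧ (1 + n - q) * b = a := by
    obtain ⟨b, hb⟩ := sub_dvd_pow_sub_pow (1 + (n : C)) q m
    refine ⟨(1 + n) ^ m - 1, b, ?_, ?_⟩
    · have : (1 : ℤ) < (1 + n) ^ m := one_lt_pow₀ (by omega) hm
      omega
    · rw [← hb, hq]; push_cast; ring
  have hreg (q : C) (hq : q ^ m = 1) (s : R) (hs : s * ι (1 + n - q) = 0) : s = 0 := by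
    obtain ⟨a, b, ha, hab⟩ := hdvd q hq
    have h1 : s * ι (a : C) = 0 := by rw [← hab, map_mul, ← mul_assoc, hs, zero_mul]
    rw [map_intCast, ← zsmul_eq_mul'] at h1
    exact (smul_eq_zero.1 h1).resolve_left ha
  have hpkm : (p ^ k) ^ m = 1 := by rw [← pow_mul, mul_comm, pow_mul, hpm, one_pow]
  have hsat' (s t : R) (hs : s * ι y' = t * ι v) : ∃ t', s = t' * ι v := by
    obtain ⟨a, b, ha, hab⟩ := hdvd (p ^ k) hpkm
    refine hsat a s (t * ι b) ha ?_
    rw [zsmul_eq_mul', ← map_intCast ι, ← hab, map_mul, ← mul_assoc, hs, mul_assoc, mul_assoc,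
      ← map_mul, ← map_mul, mul_comm v]
  have hsaty (s t : R) (hs : s * ι y = t * ι v) : ∃ t', s = t' * ι v := by
    refine hsat' s (t - s * ι (u - 1)) ?_
    rw [sub_mul, ← hs, mul_assoc, ← map_mul, ← mul_sub, ← map_sub, hy]
    ring_nf
  have hregu (t : R) (ht : t * ι (u * v) = 0) : t * ι v = 0 := by
    have h1 : t * ι (k * v) = 0 := by
      have : (k : C) * v = u * v * (1 - c * (P * (p - 1))) := by
        linear_combination -v * hc - c * hP
      rw [this, map_mul, ← mul_assoc, ht, zero_mul]
    rw [mul_comm, map_mul, ← mul_assoc, map_natCast, ← nsmul_eq_mul'] at h1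
    exact (smul_eq_zero.1 h1).resolve_left hk
  have hregy (s : R) (hs : s * ι y = 0) : s = 0 := by
    obtain ⟨t, rfl⟩ := hsaty s 0 (by rw [hs, zero_mul])
    refine hregu t (hreg p hpm _ ?_)
    rw [← hs, mul_assoc, mul_assoc, ← map_mul, ← map_mul, ← hw, mul_comm v, hyv]
    ring_nf
  let J : Submodule R R := Submodule.span R {ι v} ⊔ Submodule.span R {ι y}
  have hJ (r : R) : r ∈ J ↔ ∃ a b, r = a * ι v + b * ι y := by
    simp only [J, Submodule.mem_sup, Submodule.mem_span_singleton, smul_eq_mul]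
    constructor
    · rintro ⟨_, ⟨a, rfl⟩, _, ⟨b, rfl⟩, rfl⟩
      exact ⟨a, b, rfl⟩
    · rintro ⟨a, b, rfl⟩
      exact ⟨_, ⟨a, rfl⟩, _, ⟨b, rfl⟩, rfl⟩
  have hJ' (r : R) : r ∈ J ↔ ∃ a b, r = a * ι v + b * ι y' := by
    rw [hJ]
    constructor
    · rintro ⟨a, b, rfl⟩
      refine ⟨a + b * ι (u - 1), b, ?_⟩
      rw [hy, map_add, map_mul]
      noncomm_ring
    · rintro ⟨a, b, rfl⟩
      refine ⟨a - b * ι (u - 1), b, ?_⟩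
      rw [hy, map_add, map_mul]
      noncomm_ring
  have hyJ : Submodule.span R {ι y} ≤ J := le_sup_right
  have hyJ' : Submodule.span R {ι y'} ≤ J := by
    rw [Submodule.span_singleton_le_iff_mem, hJ']
    exact ⟨0, 1, by simp⟩
  have hle : colonIdeal (ι v) (ι y) ≤ colonIdeal (ι v) (ι (w * v)) := by
    intro r hr
    obtain ⟨s, hs⟩ := mem_colonIdeal.1 hr
    obtain ⟨t, rfl⟩ := hsaty s r hs.symm
    refine mem_colonIdeal.2 ⟨t * ι u, ?_⟩
    rw [hs, mul_assoc, mul_assoc, ← map_mul, ← map_mul, mul_comm v, hyv, mul_assoc]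
  have heq : colonIdeal (ι v) (ι y') = colonIdeal (ι v) (ι (y' * v)) := by
    ext r
    rw [mem_colonIdeal, mem_colonIdeal]
    constructor
    · rintro ⟨s, hs⟩
      obtain ⟨t, rfl⟩ := hsat' s r hs.symm
      exact ⟨t, by rw [hs, mul_assoc, ← map_mul, mul_comm v]⟩
    · rintro ⟨t, ht⟩
      exact ⟨t * ι v, by rw [ht, mul_assoc, ← map_mul, mul_comm v]⟩
  have hT : PdLeOne R (LinearMap.ker (Submodule.factor hle)) := by
    have hmem (r : R) : r * ι w ∈ colonIdeal (ι v) (ι (w * v)) :=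
      mem_colonIdeal.2 ⟨r, by rw [mul_assoc, ← map_mul]⟩
    let g : R →ₗ[R] LinearMap.ker (Submodule.factor hle) :=
      LinearMap.codRestrict _ (Submodule.mkQ _ ∘ₗ LinearMap.toSpanSingleton R R (ι w)) fun r =>
        (Submodule.Quotient.mk_eq_zero _).2 (hmem r)
    have hg : LinearMap.ker g = colonIdeal (ι v) (ι (u * v)) := by
      ext r
      rw [show LinearMap.ker g = _ from LinearMap.ker_codRestrict _ _ _, mem_colonIdeal]
      have h1 : r ∈ LinearMap.ker (Submodule.mkQ (colonIdeal (ι v) (ι y)) ∘ₗ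
          LinearMap.toSpanSingleton R R (ι w)) ↔ r * ι w ∈ colonIdeal (ι v) (ι y) :=
        Submodule.Quotient.mk_eq_zero _
      rw [h1, mem_colonIdeal]
      constructor
      · rintro ⟨s, hs⟩
        obtain ⟨t, rfl⟩ := hsaty s _ hs.symm
        refine ⟨t, sub_eq_zero.1 (hreg p hpm _ ?_)⟩
        rw [← hw, sub_mul, sub_eq_zero]
        simp only [mul_assoc, ← map_mul] at hs ⊢
        rw [mul_comm v w, hs, mul_comm v y, hyv]
        ring_nf
      · rintro ⟨t, ht⟩
        refine ⟨t * ι v, ?_⟩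
        rw [mul_assoc, ← map_mul, mul_comm w, map_mul, ← mul_assoc, ht]
        simp only [mul_assoc, ← map_mul]
        rw [mul_comm v y, hyv]
        ring_nf
    refine .of_surjective g ?_ (by rw [hg]; exact projective_colonIdeal ι hv hf hk hkn)
    rintro ⟨x, hx⟩
    obtain ⟨r, rfl⟩ := Submodule.mkQ_surjective _ x
    have hx' : r ∈ colonIdeal (ι v) (ι (w * v)) := (Submodule.Quotient.mk_eq_zero _).1 hx
    obtain ⟨s, hs⟩ := mem_colonIdeal.1 hx'
    refine ⟨s, Subtype.ext ((Submodule.Quotient.eq _).2 (mem_colonIdeal.2 ⟨0, ?_⟩))⟩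
    rw [zero_mul, sub_mul, hs, sub_eq_zero]
    exact (by rw [mul_assoc, ← map_mul] : s * ι w * ι v = s * ι (w * v))
  have := finite_quotient_span_singleton (ι y) hregy
  have := finite_quotient_span_singleton (ι y') (hreg _ hpkm)
  rw [← heq]
  let e := quotEquivKerFactor (ι v) (ι y) J hyJ hJ
  exact modEquiv_of_pullback (.quotient_span_singleton _ hregy)
    (.quotient_span_singleton _ (hreg _ hpkm)) (Submodule.factor hyJ) (Submodule.factor hyJ')
    (Submodule.factor_surjective hyJ) (Submodule.factor_surjective hyJ')
    (Submodule.factor hle ∘ₗ e.symm.toLinearMap)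
    ((Submodule.factor_surjective hle).comp e.symm.surjective)
    (hT.ker_comp e.symm _) (quotEquivKerFactor (ι v) (ι y') J hyJ' hJ').symm

open scoped IsMulCommutative in
/-- The comparison for a commuting pair of elements `v` and `p` of a ring. -/
theorem modEquiv_colonIdeal_of_commute {R : Type} [Ring R] [Module.Free ℤ R] [Module.Finite ℤ R]
    {v p : R} (hvp : Commute p v) {n f k m : ℕ} (hn : n ≠ 0)
    (hv : v * v = n * v) (hf : p ^ f * v = v) (hk : k ≠ 0) (hkn : k.Coprime (n * f))
    (hm : m ≠ 0) (hpm : p ^ m = 1)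
    (hsat : ∀ (a : ℤ) (s t : R), a ≠ 0 → a • s = t * v → ∃ t', s = t' * v) :
    ModEquiv R (R ⧸ colonIdeal v ((1 + n - p) * v))
      (R ⧸ colonIdeal v ((1 + n - p ^ k) * v)) := by
  have hcomm : ∀ a ∈ ({v, p} : Set R), ∀ b ∈ ({v, p} : Set R), a * b = b * a := by
    rintro a (rfl | rfl) b (rfl | rfl)
    exacts [rfl, hvp.eq.symm, hvp.eq, rfl]
  have := Algebra.isMulCommutative_adjoin ℤ hcomm
  have hvC : v ∈ Algebra.adjoin ℤ {v, p} := Algebra.subset_adjoin (by simp)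
  have hpC : p ∈ Algebra.adjoin ℤ {v, p} := Algebra.subset_adjoin (by simp)
  have key := modEquiv_colonIdeal ((Algebra.adjoin ℤ {v, p}).val : _ →+* R)
    (v := ⟨v, hvC⟩) (p := ⟨p, hpC⟩) hn (Subtype.ext hv) (Subtype.ext hf) hk hkn hm
    (Subtype.ext hpm) hsat
  have h (q : Algebra.adjoin ℤ {v, p}) :
      ((Algebra.adjoin ℤ {v, p}).val : _ →+* R) ((1 + n - q) * ⟨v, hvC⟩) = (1 + n - q) * v := by
    simp
  rw [h, h] at key
  exact key

end Core

section GroupAlgebra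

open MonoidAlgebra

variable {G : Type} [Group G] [Finite G]

open Classical in
/-- The sum of the elements of a subgroup in the integral group ring. -/
noncomputable def subgroupSum (I : Subgroup G) : MonoidAlgebra ℤ G :=
  ofCoeff (Finsupp.equivFunOnFinite.symm fun g => if g ∈ I then 1 else 0)

open Classical in
theorem coeff_subgroupSum (I : Subgroup G) (g : G) :
    (subgroupSum I).coeff g = if g ∈ I then 1 else 0 :=
  rfl

variable {I : Subgroup G}

theorem single_mul_subgroupSum {g h : G} (hgh : g⁻¹ * h ∈ I) (a : ℤ) :
    single g a * subgroupSum I = a • (single h 1 * subgroupSum I) := by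
  classical
  ext x
  have : g⁻¹ * x ∈ I ↔ h⁻¹ * x ∈ I := by
    rw [show g⁻¹ * x = g⁻¹ * h * (h⁻¹ * x) by group]
    exact I.mul_mem_cancel_left hgh
  rw [coeff_smul_apply, coeff_single_mul_apply, coeff_single_mul_apply, one_mul, smul_eq_mul,
    coeff_subgroupSum, coeff_subgroupSum, if_congr this rfl rfl]

theorem single_mul_subgroupSum_of_mem {g : G} (hg : g ∈ I) :
    single g 1 * subgroupSum I = subgroupSum I := by
  rw [single_mul_subgroupSum (h := 1) (by simpa using hg), ← one_def, one_mul, one_smul]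

theorem subgroupSum_mul_single_of_mem {g : G} (hg : g ∈ I) :
    subgroupSum I * single g 1 = subgroupSum I := by
  classical
  ext x
  have : x * g⁻¹ ∈ I ↔ x ∈ I := I.mul_mem_cancel_right (I.inv_mem hg)
  rw [coeff_mul_single_apply, mul_one, coeff_subgroupSum, coeff_subgroupSum,
    if_congr this rfl rfl]

theorem subgroupSum_eq_sum [Fintype I] : subgroupSum I = ∑ g : I, single (g : G) (1 : ℤ) := by
  classical
  ext x
  rw [coeff_sum, Finsupp.finsetSum_apply, coeff_subgroupSum]
  simp only [coeff_single, Finsupp.single_apply]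
  split_ifs with h
  · rw [Finset.sum_eq_single ⟨x, h⟩]
    · simp
    · exact fun g _ hg => if_neg fun h => hg (Subtype.ext h)
    · simp
  · exact (Finset.sum_eq_zero fun (g : I) _ => if_neg fun (h' : (g : G) = x) =>
      h (h' ▸ g.2)).symm

theorem subgroupSum_mul_self :
    subgroupSum I * subgroupSum I = (Nat.card I : MonoidAlgebra ℤ G) * subgroupSum I := by
  have := Fintype.ofFinite I
  have h (g : I) : single (g : G) 1 * subgroupSum I = subgroupSum I :=
    single_mul_subgroupSum_of_mem g.2
  nth_rewrite 1 [subgroupSum_eq_sum]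
  rw [Finset.sum_mul]
  simp [h, Nat.card_eq_fintype_card]

/-- The left ideal generated by the sum of a subgroup is saturated. -/
theorem exists_eq_mul_subgroupSum {a : ℤ} {s t : MonoidAlgebra ℤ G} (ha : a ≠ 0)
    (h : a • s = t * subgroupSum I) : ∃ t', s = t' * subgroupSum I := by
  classical
  have := Fintype.ofFinite (G ⧸ I)
  have hs {g x : G} (hg : g ∈ I) : s.coeff (x * g) = s.coeff x := by
    have h1 : a • (s * single g⁻¹ 1) = a • s := by
      rw [← smul_mul_assoc, h, mul_assoc, subgroupSum_mul_single_of_mem (I.inv_mem hg)]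
    have h2 := congrArg (fun z => z.coeff x) h1
    rw [coeff_smul_apply, coeff_smul_apply, coeff_mul_single_apply, mul_one, inv_inv] at h2
    exact smul_right_injective ℤ ha h2
  refine ⟨∑ q : G ⧸ I, single q.out (s.coeff q.out), ?_⟩
  ext x
  rw [Finset.sum_mul, coeff_sum, Finsupp.finsetSum_apply, Finset.sum_eq_single (x : G ⧸ I)]
  · obtain ⟨g, hg⟩ := QuotientGroup.mk_out_eq_mul I x
    simp [coeff_subgroupSum, hg, hs g.2]
  · intro q _ hq
    have : q.out⁻¹ * x ∉ I := fun h => hq (by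
      rw [← QuotientGroup.eq.2 h, QuotientGroup.out_eq'])
    simp [coeff_subgroupSum, this]
  · simp

/-- The left annihilator of the sum of a subgroup is generated by the augmentation ideal of
the subgroup. -/
theorem mem_of_mul_subgroupSum_eq_zero (L : Submodule (MonoidAlgebra ℤ G) (MonoidAlgebra ℤ G))
    (hL : ∀ g ∈ I, single g 1 - 1 ∈ L) {x : MonoidAlgebra ℤ G} (hx : x * subgroupSum I = 0) :
    x ∈ L := by
  classical
  have key (q : G ⧸ I) :
      (x * subgroupSum I).coeff q.out = Finsupp.mapDomain ((↑) : G → G ⧸ I) x.coeff q := by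
    clear hx
    induction x using MonoidAlgebra.induction_linear with
    | zero => simp
    | add x y hx hy =>
      rw [add_mul, coeff_add, Finsupp.add_apply, hx, hy, coeff_add, Finsupp.mapDomain_add,
        Finsupp.add_apply]
    | single g a =>
      have h : g⁻¹ * q.out ∈ I ↔ (g : G ⧸ I) = q := by
        rw [← QuotientGroup.eq, QuotientGroup.out_eq']
      rw [coeff_single_mul_apply, coeff_subgroupSum, if_congr h rfl rfl, mul_ite, mul_one,
        mul_zero, coeff_single, Finsupp.mapDomain_single, Finsupp.single_apply]
  have hq (x : MonoidAlgebra ℤ G) : L.mkQ x =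
      Finsupp.linearCombination ℤ (fun q : G ⧸ I => L.mkQ (single q.out 1))
        (Finsupp.mapDomain ((↑) : G → G ⧸ I) x.coeff) := by
    induction x using MonoidAlgebra.induction_linear with
    | zero => simp
    | add x y hx hy => rw [map_add, hx, hy, coeff_add, Finsupp.mapDomain_add, map_add]
    | single g a =>
      obtain ⟨h, hh⟩ := QuotientGroup.mk_out_eq_mul I g
      have h1 : single (g * h : G) (1 : ℤ) - single g 1 ∈ L := by
        have := L.smul_mem (single g 1) (hL h h.2)
        rwa [smul_eq_mul, mul_sub, single_mul_single, mul_one, mul_one] at this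
      have h2 : L.mkQ (single (g * h : G) (1 : ℤ)) = L.mkQ (single g 1) :=
        (Submodule.Quotient.eq L).2 h1
      rw [coeff_single, Finsupp.mapDomain_single, Finsupp.linearCombination_single, hh, h2,
        ← map_zsmul, smul_single, smul_eq_mul, mul_one]
  have h0 : Finsupp.mapDomain ((↑) : G → G ⧸ I) x.coeff = 0 := by
    ext q
    rw [← key, hx]
    simp
  rw [← Submodule.Quotient.mk_eq_zero, ← Submodule.mkQ_apply, hq, h0, map_zero]

variable {D : Subgroup G} [(I.subgroupOf D).Normal]

/-- Multiplication by the sum of `I` factors through the quotient by `I`. -/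
theorem mapDomain_mul_subgroupSum_eq_zero {x : MonoidAlgebra ℤ D}
    (hx : mapDomainRingHom ℤ (QuotientGroup.mk' (I.subgroupOf D)) x = 0) :
    mapDomainRingHom ℤ D.subtype x * subgroupSum I = 0 := by
  have key (x : MonoidAlgebra ℤ D) : mapDomainRingHom ℤ D.subtype x * subgroupSum I =
      Finsupp.linearCombination ℤ
        (fun q : D ⧸ I.subgroupOf D => single (q.out : G) (1 : ℤ) * subgroupSum I)
        (mapDomainRingHom ℤ (QuotientGroup.mk' (I.subgroupOf D)) x).coeff := by
    induction x using MonoidAlgebra.induction_linear with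
    | zero => simp
    | add x y hx hy => rw [map_add, add_mul, hx, hy, map_add, coeff_add, map_add]
    | single d a =>
      obtain ⟨h, hh⟩ := QuotientGroup.mk_out_eq_mul (I.subgroupOf D) d
      rw [mapDomainRingHom_apply, mapDomainRingHom_apply, mapDomain_single, mapDomain_single,
        coeff_single, Finsupp.linearCombination_single]
      refine single_mul_subgroupSum ?_ a
      rw [QuotientGroup.mk'_apply, hh]
      simpa using Subgroup.mem_subgroupOf.1 h.2
  rw [key, hx, coeff_zero, map_zero]

theorem relationIdeal_eq_colonIdeal (hID : I ≤ D) (d : D) :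
    relationIdeal G D I hID (d : D ⧸ I.subgroupOf D) = colonIdeal (subgroupSum I)
      ((1 + (Nat.card I : MonoidAlgebra ℤ G) - single (d : G)⁻¹ 1) * subgroupSum I) := by
  set π := mapDomainRingHom ℤ (QuotientGroup.mk' (I.subgroupOf D)) with hπ
  set w : MonoidAlgebra ℤ D := 1 + (Nat.card I : MonoidAlgebra ℤ D) - single d⁻¹ 1 with hw
  have hw1 : mapDomainRingHom ℤ D.subtype w =
      1 + (Nat.card I : MonoidAlgebra ℤ G) - single (d : G)⁻¹ 1 := by
    rw [hw, map_sub, map_add, map_one, map_natCast, mapDomainRingHom_apply, mapDomain_single]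
    rfl
  have hw2 : π w = 1 - MonoidAlgebra.of ℤ (D ⧸ I.subgroupOf D) (d : D ⧸ I.subgroupOf D)⁻¹ +
      (Nat.card I : MonoidAlgebra ℤ (D ⧸ I.subgroupOf D)) := by
    rw [hw, hπ, map_sub, map_add, map_one, map_natCast, mapDomainRingHom_apply,
      mapDomain_single, add_sub_right_comm]
    rfl
  have hπs : Function.Surjective π := fun z => by
    obtain ⟨x, hx⟩ := Finsupp.mapDomain_surjective (M := ℤ)
      (QuotientGroup.mk'_surjective (I.subgroupOf D)) z.coeff
    exact ⟨ofCoeff x, congrArg ofCoeff hx⟩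
  rw [← hw1]
  apply le_antisymm
  · refine Submodule.span_le.2 ?_
    rintro _ ⟨x, hx, rfl⟩
    obtain ⟨z, hz⟩ := Submodule.mem_span_singleton.1 hx
    obtain ⟨c, rfl⟩ := hπs z
    refine mem_colonIdeal.2 ⟨mapDomainRingHom ℤ D.subtype c, ?_⟩
    rw [← mul_assoc, ← map_mul, ← sub_eq_zero, ← sub_mul, ← map_sub]
    refine mapDomain_mul_subgroupSum_eq_zero ?_
    rw [map_sub, map_mul, ← hπ, hw2, sub_eq_zero]
    exact hz.symm
  · intro r hr
    obtain ⟨s, hs⟩ := mem_colonIdeal.1 hr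
    have h1 : r - s * mapDomainRingHom ℤ D.subtype w ∈
        relationIdeal G D I hID (d : D ⧸ I.subgroupOf D) := by
      refine mem_of_mul_subgroupSum_eq_zero (I := I) _ ?_
        (by rw [sub_mul, hs, mul_assoc, sub_self])
      intro g hg
      refine Submodule.subset_span ⟨single ⟨g, hID hg⟩ 1 - 1, ?_, ?_⟩
      · have : ((⟨g, hID hg⟩ : D) : D ⧸ I.subgroupOf D) = 1 :=
          (QuotientGroup.eq_one_iff _).2 (Subgroup.mem_subgroupOf.2 hg)
        rw [Set.mem_ofPred_eq, map_sub, map_one, mapDomainRingHom_apply, mapDomain_single,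
          QuotientGroup.mk'_apply, this, ← one_def, sub_self]
        exact zero_mem _
      · rw [map_sub, map_one, mapDomainRingHom_apply, mapDomain_single]
        rfl
    have h2 : mapDomainRingHom ℤ D.subtype w ∈
        relationIdeal G D I hID (d : D ⧸ I.subgroupOf D) :=
      Submodule.subset_span ⟨w, by
        rw [Set.mem_ofPred_eq, ← hw2]; exact Submodule.mem_span_singleton_self _, rfl⟩
    have h3 := Submodule.add_mem _ h1 (Submodule.smul_mem _ s h2)
    rwa [smul_eq_mul, sub_add_cancel] at h3

theorem commute_single_subgroupSum (hID : I ≤ D) (d : D) :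
    Commute (single (d : G) (1 : ℤ)) (subgroupSum I) := by
  classical
  ext x
  have : (d : G)⁻¹ * x ∈ I ↔ x * (d : G)⁻¹ ∈ I := by
    have hn : (I.subgroupOf D).Normal := inferInstance
    constructor
    · intro h
      have := hn.conj_mem ⟨_, hID h⟩ (Subgroup.mem_subgroupOf.2 h) d
      simpa [Subgroup.mem_subgroupOf, mul_assoc] using this
    · intro h
      have := hn.conj_mem ⟨_, hID h⟩ (Subgroup.mem_subgroupOf.2 h) d⁻¹
      simpa [Subgroup.mem_subgroupOf, mul_assoc] using this
  rw [coeff_mul_single_apply, coeff_single_mul_apply, mul_one, one_mul, coeff_subgroupSum,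
    coeff_subgroupSum, if_congr this rfl rfl]

end GroupAlgebra

/-- For any two generators `φ`, `φ'` of the cyclic group `D/I`, the finite
`ℤ[G]`-modules `A_{I,φ}` and `A_{I,φ'}` are equivalent. -/
theorem Amod_equiv_of_generators (G : Type) [Group G] [Finite G]
    (D I : Subgroup G) (hID : I ≤ D) [(I.subgroupOf D).Normal]
    (φ φ' : ↥D ⧸ I.subgroupOf D)
    (hφ : ∀ x : ↥D ⧸ I.subgroupOf D, x ∈ Subgroup.zpowers φ)
    (hφ' : ∀ x : ↥D ⧸ I.subgroupOf D, x ∈ Subgroup.zpowers φ') :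
    ModEquiv (MonoidAlgebra ℤ G) (Amod G D I hID φ) (Amod G D I hID φ') := by
  classical
  obtain ⟨d, rfl⟩ := QuotientGroup.mk_surjective φ
  have hcard : ∀ ψ : ↥D ⧸ I.subgroupOf D, (∀ x, x ∈ Subgroup.zpowers ψ) →
      orderOf ψ = Nat.card (↥D ⧸ I.subgroupOf D) := fun ψ h =>
    orderOf_eq_card_of_forall_mem_zpowers h
  obtain ⟨k₀, rfl⟩ : ∃ k₀ : ℕ, (d : ↥D ⧸ I.subgroupOf D) ^ k₀ = φ' :=
    mem_powers_iff_mem_zpowers.2 (hφ φ')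
  set f := Nat.card (↥D ⧸ I.subgroupOf D) with hf
  have hf0 : 0 < f := Nat.card_pos
  have hn0 : 0 < Nat.card I := Nat.card_pos
  have hk₀ : k₀.Coprime f := by
    have h1 := orderOf_pow (x := (d : ↥D ⧸ I.subgroupOf D)) (n := k₀)
    rw [hcard _ hφ', hcard _ hφ] at h1
    have h2 := Nat.gcd_dvd_left f k₀
    rw [eq_comm, Nat.div_eq_self] at h1
    rw [Nat.coprime_comm]
    exact h1.resolve_left hf0.ne'
  obtain ⟨k, hk0, hk, hkf⟩ : ∃ k : ℕ, k ≠ 0 ∧ k.Coprime (Nat.card I * f) ∧ k ≡ k₀ [MOD f] := by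
    have : NeZero (Nat.card I * f) := ⟨by positivity⟩
    obtain ⟨u, hu⟩ := ZMod.unitsMap_surjective (Dvd.intro_left (Nat.card I) rfl)
      (ZMod.unitOfCoprime k₀ hk₀)
    refine ⟨(u : ZMod (Nat.card I * f)).val + Nat.card I * f, by positivity, ?_, ?_⟩
    · simpa using ZMod.val_coe_unit_coprime u
    · rw [← ZMod.natCast_eq_natCast_iff]
      have h1 := congrArg Units.val hu
      rw [ZMod.coe_unitOfCoprime, ZMod.unitsMap_val] at h1
      rw [← h1]
      simp
  have hpow : (d : ↥D ⧸ I.subgroupOf D) ^ k₀ = ((d ^ k : D) : ↥D ⧸ I.subgroupOf D) := by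
    rw [QuotientGroup.mk_pow, pow_eq_pow_iff_modEq, hcard _ hφ]
    exact hkf.symm
  have hpow' (j : ℕ) : (MonoidAlgebra.single (d : G)⁻¹ 1 : MonoidAlgebra ℤ G) ^ j =
      MonoidAlgebra.single ((d : G) ^ j)⁻¹ 1 := by
    rw [MonoidAlgebra.single_pow, one_pow, inv_pow]
  have hpf : (MonoidAlgebra.single (d : G)⁻¹ 1 : MonoidAlgebra ℤ G) ^ f * subgroupSum I =
      subgroupSum I := by
    have h : ((d ^ f : D) : ↥D ⧸ I.subgroupOf D) = 1 := by
      rw [QuotientGroup.mk_pow, hf, pow_card_eq_one']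
    have h2 := Subgroup.mem_subgroupOf.1 ((QuotientGroup.eq_one_iff _).1 h)
    rw [hpow']
    exact single_mul_subgroupSum_of_mem (I.inv_mem h2)
  have hpm : (MonoidAlgebra.single (d : G)⁻¹ 1 : MonoidAlgebra ℤ G) ^ orderOf (d : G) = 1 := by
    rw [hpow', pow_orderOf_eq_one, inv_one, MonoidAlgebra.one_def]
  have hcomm : Commute (MonoidAlgebra.single (d : G)⁻¹ (1 : ℤ)) (subgroupSum I) :=
    commute_single_subgroupSum hID d⁻¹
  have key := modEquiv_colonIdeal_of_commute hcomm
    hn0.ne' subgroupSum_mul_self hpf hk0 hk (orderOf_pos _).ne' hpm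
    (fun a s t ha h => exists_eq_mul_subgroupSum ha h)
  have h1 := relationIdeal_eq_colonIdeal hID d
  have h2 := relationIdeal_eq_colonIdeal hID (d ^ k)
  rw [SubmonoidClass.coe_pow, ← hpow' k, ← hpow] at h2
  rw [← h1, ← h2] at key
  exact key
end
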